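/- Let μ₁, μ₂ be σ-finite measures on measurable spaces Z₁, Z₂, f : Z₁ × Z₂ → (0,∞) measurable, and q₂ a probability density with respect to μ₂ with ∫ q₂ |log q₂| dμ₂ < ∞ and ∫ q₂(z₂)|log f(z₁,z₂)| dμ₂(z₂) < ∞ for every z₁. Define log c(z₁) := ∫ q₂(z₂) log f(z₁,z₂) dμ₂(z₂). Let I ⊆ ℝ be an open interval and q₁ : Z₁ × I → (0,∞) measurable with ∫ q₁(z₁,λ) dμ₁(z₁) = 1 for every λ ∈ I. Fix λ₀ ∈ I and assume: (a) for μ₁-a.e. z₁, λ ↦ q₁(z₁,λ) is differentiable on I with derivative ∂_λ q₁(z₁,λ); (b) there is a μ₁-integrable g and a neighborhood J ⊆ I of λ₀ with |∂_λ q₁(z₁,λ)| · (1 + |log c(z₁)| + |log q₁(z₁,λ)|) ≤ g(z₁) for all λ ∈ J and μ₁-a.e. z₁; (c) ∫ q₁(z₁,λ₀)(|log c(z₁)| + |log q₁(z₁,λ₀)|) dμ₁(z₁) < ∞. Then λ ↦ ELBO(q₁(·,λ), q₂) is differentiable at λ₀ with derivative ∫ q₁(z₁,λ₀) · (∂_λ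 q₁(z₁,λ₀)/q₁(z₁,λ₀)) · (log c(z₁) − log q₁(z₁,λ₀)) dμ₁(z₁). -/

import Mathlib

open MeasureTheory Filter Topology

/-- The mean-field ELBO of the product density `r(z₁) q₂(z₂)`:
`∫∫ r q₂ log f dμ₂ dμ₁ − ∫ r log r dμ₁ − ∫ q₂ log q₂ dμ₂`. -/
noncomputable def meanFieldELBO' {Z₁ Z₂ : Type*} [MeasurableSpace Z₁] [MeasurableSpace Z₂]
    (μ₁ : Measure Z₁) (μ₂ : Measure Z₂) (f : Z₁ × Z₂ → ℝ)
    (q₂ : Z₂ → ℝ) (r : Z₁ → ℝ) : ℝ :=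
  (∫ z₁, (∫ z₂, r z₁ * q₂ z₂ * Real.log (f (z₁, z₂)) ∂μ₂) ∂μ₁)
    - (∫ z₁, r z₁ * Real.log (r z₁) ∂μ₁)
    - ∫ z₂, q₂ z₂ * Real.log (q₂ z₂) ∂μ₂

/-- The pointwise derivative in a real parameter of a family of a.e. strongly measurable functions
is a.e. strongly measurable. -/
theorem aestronglyMeasurable_of_ae_hasDerivAt {α : Type*} [MeasurableSpace α] {μ : Measure α}
    {F : ℝ → α → ℝ} {F' : α → ℝ} {x₀ : ℝ} (hF : ∀ x, AEStronglyMeasurable (F x) μ)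
    (h : ∀ᵐ z ∂μ, HasDerivAt (F · z) (F' z) x₀) : AEStronglyMeasurable F' μ := by
  refine aestronglyMeasurable_of_tendsto_ae (𝓝[≠] x₀)
    (f := fun x z => (x - x₀)⁻¹ * (F x z - F x₀ z))
    (fun x => ((hF x).sub (hF x₀)).const_mul _) ?_
  filter_upwards [h] with z hz
  refine (hasDerivAt_iff_tendsto_slope.1 hz).congr fun x => ?_
  simp [slope, smul_eq_mul]

/-- Rao–Blackwellized gradient identity used by BBVI: the derivative at `λ₀` of
`λ ↦ ELBO(q₁(·,λ), q₂)` equals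
`∫ q₁(z₁,λ₀) ∂_λ log q₁(z₁,λ₀) (log c(z₁) − log q₁(z₁,λ₀)) dμ₁`, where
`log c(z₁) = ∫ q₂(z₂) log f(z₁,z₂) dμ₂`. -/
theorem mc_cavi_stmt15 {Z₁ Z₂ : Type*} [MeasurableSpace Z₁] [MeasurableSpace Z₂]
    (μ₁ : Measure Z₁) (μ₂ : Measure Z₂) [SigmaFinite μ₁] [SigmaFinite μ₂]
    (f : Z₁ × Z₂ → ℝ) (hfmeas : Measurable f) (hfpos : ∀ zz, 0 < f zz)
    (q₂ : Z₂ → ℝ) (hq₂meas : Measurable q₂) (hq₂0 : ∀ z, 0 ≤ q₂ z)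
    (hq₂norm : (∫ z, q₂ z ∂μ₂) = 1)
    (hq₂logq₂ : Integrable (fun z => q₂ z * Real.log (q₂ z)) μ₂)
    (hq₂logf : ∀ z₁ : Z₁, Integrable (fun z₂ => q₂ z₂ * Real.log (f (z₁, z₂))) μ₂)
    (logc : Z₁ → ℝ) (hlogc : ∀ z₁, logc z₁ = ∫ z₂, q₂ z₂ * Real.log (f (z₁, z₂)) ∂μ₂)
    (a b : ℝ) (I : Set ℝ) (hI : I = Set.Ioo a b)
    (q₁ q₁' : Z₁ → ℝ → ℝ)
    (hq₁meas : Measurable fun zl : Z₁ × ℝ => q₁ zl.1 zl.2)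
    (hq₁pos : ∀ z₁ : Z₁, ∀ lam ∈ I, 0 < q₁ z₁ lam)
    (hq₁norm : ∀ lam ∈ I, (∫ z₁, q₁ z₁ lam ∂μ₁) = 1)
    (lam₀ : ℝ) (hlam₀ : lam₀ ∈ I)
    -- (a) a.e. differentiability in the parameter
    (hderiv : ∀ᵐ z₁ ∂μ₁, ∀ lam ∈ I, HasDerivAt (fun t => q₁ z₁ t) (q₁' z₁ lam) lam)
    -- (b) domination on a neighborhood of lam₀
    (g : Z₁ → ℝ) (hg : Integrable g μ₁)
    (J : Set ℝ) (hJ : J ∈ 𝓝 lam₀) (hJI : J ⊆ I)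
    (hbound : ∀ᵐ z₁ ∂μ₁, ∀ lam ∈ J,
      |q₁' z₁ lam| * (1 + |logc z₁| + |Real.log (q₁ z₁ lam)|) ≤ g z₁)
    -- (c) integrability at lam₀
    (hint : Integrable
      (fun z₁ => q₁ z₁ lam₀ * (|logc z₁| + |Real.log (q₁ z₁ lam₀)|)) μ₁) :
    HasDerivAt
      (fun lam => meanFieldELBO' μ₁ μ₂ f q₂ (fun z₁ => q₁ z₁ lam))
      (∫ z₁, q₁ z₁ lam₀ * (q₁' z₁ lam₀ / q₁ z₁ lam₀)
          * (logc z₁ - Real.log (q₁ z₁ lam₀)) ∂μ₁)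
      lam₀ := by
  have hqm : ∀ t, Measurable fun z => q₁ z t := fun t =>
    hq₁meas.comp (measurable_id.prodMk measurable_const)
  have hlm : Measurable logc := by
    rw [funext hlogc]
    refine (StronglyMeasurable.integral_prod_right' (ν := μ₂)
      (f := fun p : Z₁ × Z₂ => q₂ p.2 * Real.log (f p)) ?_).measurable
    exact ((hq₂meas.comp measurable_snd).mul hfmeas.log).stronglyMeasurable
  have hq'm : AEStronglyMeasurable (fun z => q₁' z lam₀) μ₁ :=
    aestronglyMeasurable_of_ae_hasDerivAt (F := fun t z => q₁ z t)
      (fun t => (hqm t).aestronglyMeasurable) (hderiv.mono fun z hz => hz lam₀ hlam₀)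
  have hinner : ∀ t, (∫ z₁, (∫ z₂, q₁ z₁ t * q₂ z₂ * Real.log (f (z₁, z₂)) ∂μ₂) ∂μ₁)
      = ∫ z₁, q₁ z₁ t * logc z₁ ∂μ₁ := fun t => by
    refine integral_congr_ae (Eventually.of_forall fun z₁ => ?_)
    simp only [hlogc, mul_assoc, integral_const_mul]
  have hq_int : Integrable (fun z => q₁ z lam₀) μ₁ :=
    .of_integral_ne_zero (by rw [hq₁norm lam₀ hlam₀]; exact one_ne_zero)
  have hqc_int : Integrable (fun z => q₁ z lam₀ * logc z) μ₁ := by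
    refine hint.mono' ((hqm lam₀).mul hlm).aestronglyMeasurable (.of_forall fun z => ?_)
    have h0 := hq₁pos z lam₀ hlam₀
    rw [Real.norm_eq_abs, abs_mul, abs_of_pos h0]
    gcongr
    linarith [abs_nonneg (Real.log (q₁ z lam₀))]
  have hql_int : Integrable (fun z => q₁ z lam₀ * Real.log (q₁ z lam₀)) μ₁ := by
    refine hint.mono' ((hqm lam₀).mul (hqm lam₀).log).aestronglyMeasurable
      (.of_forall fun z => ?_)
    have h0 := hq₁pos z lam₀ hlam₀
    rw [Real.norm_eq_abs, abs_mul, abs_of_pos h0]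
    gcongr
    linarith [abs_nonneg (logc z)]
  have hderivJ : ∀ᵐ z ∂μ₁, ∀ t ∈ J, HasDerivAt (fun t => q₁ z t) (q₁' z t) t :=
    hderiv.mono fun z hz t ht => hz t (hJI ht)
  obtain ⟨hA_int, hA⟩ := hasDerivAt_integral_of_dominated_loc_of_deriv_le (μ := μ₁)
    (F := fun t z => q₁ z t) (F' := fun t z => q₁' z t) (bound := g) hJ
    (.of_forall fun t => (hqm t).aestronglyMeasurable) hq_int hq'm
    (by
      filter_upwards [hbound] with z hz t ht
      refine le_trans ?_ (hz t ht)
      rw [Real.norm_eq_abs]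
      exact le_mul_of_one_le_right (abs_nonneg _)
        (by linarith [abs_nonneg (logc z), abs_nonneg (Real.log (q₁ z t))])) hg hderivJ
  obtain ⟨hB_int, hB⟩ := hasDerivAt_integral_of_dominated_loc_of_deriv_le (μ := μ₁)
    (F := fun t z => q₁ z t * logc z) (F' := fun t z => q₁' z t * logc z) (bound := g) hJ
    (.of_forall fun t => ((hqm t).mul hlm).aestronglyMeasurable) hqc_int
    (hq'm.mul hlm.aestronglyMeasurable)
    (by
      filter_upwards [hbound] with z hz t ht
      refine le_trans ?_ (hz t ht)
      rw [Real.norm_eq_abs, abs_mul]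
      gcongr
      linarith [abs_nonneg (Real.log (q₁ z t))]) hg
    (hderivJ.mono fun z hz t ht => (hz t ht).mul_const _)
  obtain ⟨hC_int, hC⟩ := hasDerivAt_integral_of_dominated_loc_of_deriv_le (μ := μ₁)
    (F := fun t z => q₁ z t * Real.log (q₁ z t))
    (F' := fun t z => (Real.log (q₁ z t) + 1) * q₁' z t) (bound := g) hJ
    (.of_forall fun t => ((hqm t).mul (hqm t).log).aestronglyMeasurable) hql_int
    (((hqm lam₀).log.add_const 1).aestronglyMeasurable.mul hq'm)
    (by
      filter_upwards [hbound] with z hz t ht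
      refine le_trans ?_ (hz t ht)
      rw [Real.norm_eq_abs, abs_mul, mul_comm]
      gcongr
      have := abs_add_le (Real.log (q₁ z t)) 1
      rw [abs_one] at this
      linarith [abs_nonneg (logc z)]) hg
    (hderivJ.mono fun z hz t ht =>
      (Real.hasDerivAt_mul_log (hq₁pos z t (hJI ht)).ne').comp t (hz t ht))
  have hA_zero : ∫ z, q₁' z lam₀ ∂μ₁ = 0 := by
    refine hA.unique ((hasDerivAt_const lam₀ (1 : ℝ)).congr_of_eventuallyEq ?_)
    filter_upwards [hJ] with t ht using hq₁norm t (hJI ht)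
  have hvalue : (∫ z₁, q₁ z₁ lam₀ * (q₁' z₁ lam₀ / q₁ z₁ lam₀)
      * (logc z₁ - Real.log (q₁ z₁ lam₀)) ∂μ₁)
      = (∫ z, q₁' z lam₀ * logc z ∂μ₁)
        - ∫ z, (Real.log (q₁ z lam₀) + 1) * q₁' z lam₀ ∂μ₁ := by
    rw [← integral_sub hB_int hC_int, ← add_zero (∫ z, _ - _ ∂μ₁), ← hA_zero]
    refine Eq.trans (integral_congr_ae (.of_forall fun z => ?_))
      (integral_add (hB_int.sub hC_int) hA_int)
    dsimp only
    rw [mul_div_cancel₀ _ (hq₁pos z lam₀ hlam₀).ne']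
    ring
  rw [hvalue]
  simp only [meanFieldELBO', hinner]
  exact (hB.sub hC).sub_const _
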